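/- Let s > 1 and define u(x,t) = ∫₀^∞ exp(-ρx²/2 + iρt - ρ^{1/s}) dρ for (x,t) ∈ ℝ². Then u is a well-defined smooth function and satisfies the PDE D_x² u + x² D_t² u - D_t u = 0, where D = (1/i)∂. -/

import Mathlib

open MeasureTheory Complex

theorem integrableOn_pow_mul_exp_neg_rpow {r : ℝ} (hr : 0 < r) (k : ℕ) :
    IntegrableOn (fun ρ : ℝ => ρ ^ k * Real.exp (-ρ ^ r)) (Set.Ioi 0) := by
  simpa only [Real.rpow_natCast] using integrableOn_rpow_mul_exp_neg_rpow (s := k)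
    (neg_one_lt_zero.trans_le k.cast_nonneg) hr

/-- The phase `-ρx²/2 + iρt - ρ^r` at the point `p = (x, t)`. -/
noncomputable def gevreyPhase (r ρ : ℝ) (p : ℝ × ℝ) : ℂ :=
  -(ρ * p.1 ^ 2 / 2 : ℝ) + I * (ρ : ℂ) * (p.2 : ℂ) - (ρ ^ r : ℝ)

/-- The `k`-th moment in `ρ` of the oscillating exponential with phase `gevreyPhase`. -/
noncomputable def gevreyMoment (r : ℝ) (k : ℕ) (p : ℝ × ℝ) : ℂ :=
  ∫ ρ in Set.Ioi (0 : ℝ), (ρ : ℂ) ^ k * cexp (gevreyPhase r ρ p)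

/-- The differential of the phase in `(x, t)`, divided by `ρ`. -/
noncomputable def gevreyPhaseDeriv (p : ℝ × ℝ) : ℝ × ℝ →L[ℝ] ℂ :=
  I • ofRealCLM.comp (ContinuousLinearMap.snd ℝ ℝ ℝ)
    - p.1 • ofRealCLM.comp (ContinuousLinearMap.fst ℝ ℝ ℝ)

theorem gevreyPhaseDeriv_apply (p v : ℝ × ℝ) :
    gevreyPhaseDeriv p v = I * v.2 - p.1 * v.1 := by
  simp [gevreyPhaseDeriv]

theorem contDiff_gevreyPhaseDeriv {n : WithTop ℕ∞} : ContDiff ℝ n gevreyPhaseDeriv := by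
  unfold gevreyPhaseDeriv
  fun_prop

theorem hasFDerivAt_gevreyPhase (r ρ : ℝ) (p : ℝ × ℝ) :
    HasFDerivAt (gevreyPhase r ρ) ((ρ : ℂ) • gevreyPhaseDeriv p) p := by
  have h₁ : HasFDerivAt (fun q : ℝ × ℝ => (q.1 : ℂ))
      (ofRealCLM.comp (ContinuousLinearMap.fst ℝ ℝ ℝ)) p :=
    (ofRealCLM.comp (ContinuousLinearMap.fst ℝ ℝ ℝ)).hasFDerivAt
  have h₂ : HasFDerivAt (fun q : ℝ × ℝ => (q.2 : ℂ))
      (ofRealCLM.comp (ContinuousLinearMap.snd ℝ ℝ ℝ)) p :=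
    (ofRealCLM.comp (ContinuousLinearMap.snd ℝ ℝ ℝ)).hasFDerivAt
  have h := (((h₁.pow 2).const_mul (-(ρ : ℂ) / 2)).add (h₂.const_mul (I * ρ))).sub_const
    ((ρ ^ r : ℝ) : ℂ)
  convert! h using 1
  · ext q
    simp [gevreyPhase]
    ring
  · refine ContinuousLinearMap.ext fun v => ?_
    simp [gevreyPhaseDeriv_apply]
    ring

theorem norm_pow_mul_exp_gevreyPhase_le (r : ℝ) (k : ℕ) {ρ : ℝ} (hρ : 0 < ρ) (p : ℝ × ℝ) :
    ‖(ρ : ℂ) ^ k * cexp (gevreyPhase r ρ p)‖ ≤ ρ ^ k * Real.exp (-ρ ^ r) := by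
  have hre : (gevreyPhase r ρ p).re = -(ρ * p.1 ^ 2 / 2) - ρ ^ r := by
    simp only [gevreyPhase, sub_re, add_re, neg_re, ofReal_re, mul_re, mul_im, I_re, I_im,
      ofReal_im]
    ring
  rw [norm_mul, norm_pow, norm_real, Real.norm_of_nonneg hρ.le, norm_exp, hre]
  gcongr
  have : 0 ≤ ρ * p.1 ^ 2 / 2 := by positivity
  linarith

theorem continuous_pow_mul_exp_gevreyPhase {r : ℝ} (hr : 0 < r) (k : ℕ) (p : ℝ × ℝ) :
    Continuous fun ρ : ℝ => (ρ : ℂ) ^ k * cexp (gevreyPhase r ρ p) := by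
  have : Continuous fun ρ : ℝ => ρ ^ r := Real.continuous_rpow_const hr.le
  unfold gevreyPhase
  fun_prop

theorem integrableOn_pow_mul_exp_gevreyPhase {r : ℝ} (hr : 0 < r) (k : ℕ) (p : ℝ × ℝ) :
    IntegrableOn (fun ρ : ℝ => (ρ : ℂ) ^ k * cexp (gevreyPhase r ρ p)) (Set.Ioi 0) :=
  (integrableOn_pow_mul_exp_neg_rpow hr k).mono'
    (continuous_pow_mul_exp_gevreyPhase hr k p).aestronglyMeasurable
    (ae_restrict_of_forall_mem measurableSet_Ioi fun _ hρ =>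
      norm_pow_mul_exp_gevreyPhase_le r k hρ p)

theorem hasFDerivAt_gevreyMoment {r : ℝ} (hr : 0 < r) (k : ℕ) (p : ℝ × ℝ) :
    HasFDerivAt (gevreyMoment r k) (gevreyMoment r (k + 1) p • gevreyPhaseDeriv p) p := by
  set C : ℝ := ‖gevreyPhaseDeriv p‖ + 1
  have hC : {q | ‖gevreyPhaseDeriv q‖ < C} ∈ nhds p :=
    ((contDiff_gevreyPhaseDeriv (n := 0)).continuous.norm.tendsto p).eventually_lt_const
      (lt_add_one _)
  have h := hasFDerivAt_integral_of_dominated_of_fderiv_le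
    (μ := volume.restrict (Set.Ioi (0 : ℝ)))
    (F := fun q ρ => (ρ : ℂ) ^ k * cexp (gevreyPhase r ρ q))
    (F' := fun q ρ => ((ρ : ℂ) ^ (k + 1) * cexp (gevreyPhase r ρ q)) • gevreyPhaseDeriv q)
    (bound := fun ρ => ρ ^ (k + 1) * Real.exp (-ρ ^ r) * C) hC
    (Filter.Eventually.of_forall fun q =>
      (continuous_pow_mul_exp_gevreyPhase hr k q).aestronglyMeasurable)
    (integrableOn_pow_mul_exp_gevreyPhase hr k p)
    ((continuous_pow_mul_exp_gevreyPhase hr (k + 1) p).smul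
      continuous_const).aestronglyMeasurable
    (ae_restrict_of_forall_mem measurableSet_Ioi fun ρ hρ q hq => by
      rw [norm_smul]
      exact mul_le_mul (norm_pow_mul_exp_gevreyPhase_le r (k + 1) hρ q) (le_of_lt hq)
        (norm_nonneg _) (mul_nonneg (pow_nonneg (le_of_lt hρ) _) (Real.exp_pos _).le))
    ((integrableOn_pow_mul_exp_neg_rpow hr (k + 1)).mul_const C)
    (ae_restrict_of_forall_mem measurableSet_Ioi fun ρ _ q _ => by
      convert! (hasFDerivAt_gevreyPhase r ρ q).cexp.const_mul ((ρ : ℂ) ^ k) using 1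
      simp only [smul_smul]
      congr 1
      ring)
  rwa [integral_smul_const] at h

theorem contDiff_gevreyMoment {r : ℝ} (hr : 0 < r) (k n : ℕ) :
    ContDiff ℝ n (gevreyMoment r k) := by
  induction n generalizing k with
  | zero =>
    exact contDiff_zero.2 (continuous_iff_continuousAt.2 fun p =>
      (hasFDerivAt_gevreyMoment hr k p).continuousAt)
  | succ n ih =>
    push_cast
    exact contDiff_succ_iff_hasFDerivAt.2
      ⟨_, (ih (k + 1)).smul contDiff_gevreyPhaseDeriv, hasFDerivAt_gevreyMoment hr k⟩

theorem hasDerivAt_gevreyMoment_fst {r : ℝ} (hr : 0 < r) (k : ℕ) (x t : ℝ) :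
    HasDerivAt (fun y => gevreyMoment r k (y, t)) (-(x * gevreyMoment r (k + 1) (x, t))) x := by
  have h := (hasFDerivAt_gevreyMoment hr k (x, t)).comp_hasDerivAt x
    ((hasDerivAt_id x).prodMk (hasDerivAt_const x t))
  convert! h using 1
  simp [gevreyPhaseDeriv_apply]
  ring

theorem hasDerivAt_gevreyMoment_snd {r : ℝ} (hr : 0 < r) (k : ℕ) (x t : ℝ) :
    HasDerivAt (fun y => gevreyMoment r k (x, y)) (I * gevreyMoment r (k + 1) (x, t)) t := by
  have h := (hasFDerivAt_gevreyMoment hr k (x, t)).comp_hasDerivAt t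
    ((hasDerivAt_const t x).prodMk (hasDerivAt_id t))
  convert! h using 1
  simp [gevreyPhaseDeriv_apply]
  ring



/-- For s > 1, the function u(x,t) = ∫₀^∞ exp(-ρx²/2 + iρt - ρ^{1/s}) dρ is
well defined (the integrand is integrable on (0,∞)), smooth on ℝ², and satisfies
D_x² u + x² D_t² u - D_t u = 0 with D = (1/i)∂, i.e.
-∂_x²u - x²∂_t²u + i∂_t u = 0. -/
theorem gevrey_solution_of_model_operator (s : ℝ) (hs : 1 < s)
    (u : ℝ → ℝ → ℂ)
    (hu : ∀ x t : ℝ, u x t =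
      ∫ ρ in Set.Ioi (0 : ℝ),
        Complex.exp (-(ρ * x ^ 2 / 2 : ℝ) + Complex.I * (ρ : ℂ) * (t : ℂ)
          - (ρ ^ (1 / s) : ℝ))) :
    (∀ x t : ℝ, IntegrableOn
      (fun ρ : ℝ => Complex.exp (-(ρ * x ^ 2 / 2 : ℝ) + Complex.I * (ρ : ℂ) * (t : ℂ)
          - (ρ ^ (1 / s) : ℝ))) (Set.Ioi (0 : ℝ)))
    ∧ ContDiff ℝ (⊤ : ℕ∞) (fun p : ℝ × ℝ => u p.1 p.2)
    ∧ ∀ x t : ℝ,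
        -(deriv (fun x' : ℝ => deriv (fun x'' : ℝ => u x'' t) x') x)
        - (x : ℂ) ^ 2 * (deriv (fun t' : ℝ => deriv (fun t'' : ℝ => u x t'') t') t)
        + Complex.I * deriv (fun t' : ℝ => u x t') t = 0 := by
  have hr : 0 < 1 / s := by positivity
  have hu' : ∀ x t, u x t = gevreyMoment (1 / s) 0 (x, t) := fun x t => by
    simp only [hu, gevreyMoment, gevreyPhase, pow_zero, one_mul]
  refine ⟨fun x t => ?_, ?_, fun x t => ?_⟩
  · simpa only [gevreyPhase, pow_zero, one_mul] using
      integrableOn_pow_mul_exp_gevreyPhase hr 0 (x, t)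
  · simp only [hu']
    exact contDiff_infty.2 fun n => contDiff_gevreyMoment hr 0 n
  · have hx : (fun y => deriv (fun z => u z t) y) =
        fun y : ℝ => -((y : ℂ) * gevreyMoment (1 / s) 1 (y, t)) := funext fun y => by
      simp only [hu']
      exact (hasDerivAt_gevreyMoment_fst hr 0 y t).deriv
    have ht : (fun y => deriv (fun z => u x z) y) =
        fun y : ℝ => I * gevreyMoment (1 / s) 1 (x, y) := funext fun y => by
      simp only [hu']
      exact (hasDerivAt_gevreyMoment_snd hr 0 x y).deriv
    have hxx : HasDerivAt (fun y : ℝ => -((y : ℂ) * gevreyMoment (1 / s) 1 (y, t))) _ x :=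
      ((hasDerivAt_id x).ofReal_comp.mul (hasDerivAt_gevreyMoment_fst hr 1 x t)).neg
    have htt := (hasDerivAt_gevreyMoment_snd hr 1 x t).const_mul I
    rw [hx, ht, congrFun ht t, hxx.deriv, htt.deriv]
    simp only [id, ofReal_one]
    linear_combination (gevreyMoment (1 / s) 1 (x, t)
      - (x : ℂ) ^ 2 * gevreyMoment (1 / s) 2 (x, t)) * I_mul_I
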